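/- There exists a constant C₀ > 0 such that the following holds. Let μ ∈ (0,1], δ₀ ∈ (0,1/2), and let k be a nonzero integer. Let U : [0,∞) × [-1,1] → ℝ be smooth with |∂_y U(t,y) - 1| ≤ δ₀, |∂_y² U(t,y)| ≤ δ₀ and |∂_y³ U(t,y)| ≤ δ₀ for all t ≥ 0, y ∈ [-1,1]. Let ω, ψ, θ : [0,∞) × [-1,1] → ℂ be smooth with ω(t,±1) = 0, ψ(t,±1) = 0 and θ(t,±1) = 0 for all t ≥ 0, satisfying ∂_y² ψ - k²·ψ = ω and ∂_t ω + i·k·U·ω - i·k·(∂_y² U)·ψ - μ·∂_y² ω = -i·k·θ on [0,∞) × [-1,1]. Then for every t ≥ 0: (1/2)·(d/dt)[μ^{2/3}·|k|^{-2/3}·‖∂_y ω(t,·)‖²_{L²}] + (1/2)·μ^{5/3}·|k|^{-2/3}·‖∂_y² ω(t,·)‖²_{L²} ≤ (16 + C₀·δ₀/2)·μ·‖∂_y ω(t,·)‖²_{L²} + (1/16 + C₀·δ₀/2)·μ^{1/3}·|k|^{2/3}·‖ω(t,·)‖²_{L²} + C₀·μ^{-1/3}·|k|^{4/3}·‖θ(t,·)‖²_{L²}.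 -/

import Mathlib

open Set

section PartialDerivatives

variable {E : Type*} [NormedAddCommGroup E] [NormedSpace ℝ E] {f : ℝ → ℝ → E}

theorem hasDerivAt_snd_of_contDiff_uncurry (hf : ContDiff ℝ (⊤ : ℕ∞) (Function.uncurry f))
    (t y : ℝ) : HasDerivAt (f t) (fderiv ℝ (Function.uncurry f) (t, y) (0, 1)) y :=
  ((hf.differentiable (by simp)) (t, y)).hasFDerivAt.comp_hasDerivAt y
    ((hasDerivAt_const y t).prodMk (hasDerivAt_id y))

theorem hasDerivAt_fst_of_contDiff_uncurry (hf : ContDiff ℝ (⊤ : ℕ∞) (Function.uncurry f))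
    (t y : ℝ) :
    HasDerivAt (fun s => f s y) (fderiv ℝ (Function.uncurry f) (t, y) (1, 0)) t :=
  ((hf.differentiable (by simp)) (t, y)).hasFDerivAt.comp_hasDerivAt (f := fun s => (s, y)) t
    ((hasDerivAt_id t).prodMk (hasDerivAt_const t y))

theorem contDiff_fderiv_uncurry_apply (hf : ContDiff ℝ (⊤ : ℕ∞) (Function.uncurry f))
    (v : ℝ × ℝ) : ContDiff ℝ (⊤ : ℕ∞) fun p => fderiv ℝ (Function.uncurry f) p v :=
  (hf.fderiv_right (m := (⊤ : ℕ∞)) (by simp)).clm_apply contDiff_const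

theorem contDiff_uncurry_deriv_snd (hf : ContDiff ℝ (⊤ : ℕ∞) (Function.uncurry f)) :
    ContDiff ℝ (⊤ : ℕ∞) (Function.uncurry fun t y => deriv (f t) y) := by
  convert contDiff_fderiv_uncurry_apply hf (0, 1) using 1
  ext ⟨t, y⟩
  exact (hasDerivAt_snd_of_contDiff_uncurry hf t y).deriv

theorem contDiff_uncurry_deriv_fst (hf : ContDiff ℝ (⊤ : ℕ∞) (Function.uncurry f)) :
    ContDiff ℝ (⊤ : ℕ∞) (Function.uncurry fun t y => deriv (fun s => f s y) t) := by
  convert contDiff_fderiv_uncurry_apply hf (1, 0) using 1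
  ext ⟨t, y⟩
  exact (hasDerivAt_fst_of_contDiff_uncurry hf t y).deriv

theorem deriv_fst_deriv_snd_comm (hf : ContDiff ℝ (⊤ : ℕ∞) (Function.uncurry f)) (t y : ℝ) :
    deriv (fun s => deriv (f s) y) t = deriv (fun z => deriv (fun s => f s z) t) y := by
  have hsymm := (hf.contDiffAt (x := (t, y))).isSymmSndFDerivAt
    (by simpa using WithTop.coe_le_coe.2 (le_top : (2 : ℕ∞) ≤ ⊤)) |>.eq (1, 0) (0, 1)
  have hd : DifferentiableAt ℝ (fderiv ℝ (Function.uncurry f)) (t, y) :=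
    ((hf.fderiv_right (m := (⊤ : ℕ∞)) (by simp)).differentiable (by simp)) _
  have h₁ := (hd.hasFDerivAt.comp_hasDerivAt (f := fun s => (s, y)) t
    ((hasDerivAt_id t).prodMk (hasDerivAt_const t y))).clm_apply
      (hasDerivAt_const t ((0, 1) : ℝ × ℝ))
  have h₂ := (hd.hasFDerivAt.comp_hasDerivAt (f := fun z => (t, z)) y
    ((hasDerivAt_const y t).prodMk (hasDerivAt_id y))).clm_apply
      (hasDerivAt_const y ((1, 0) : ℝ × ℝ))
  simp only [(hasDerivAt_snd_of_contDiff_uncurry hf _ _).deriv,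
    (hasDerivAt_fst_of_contDiff_uncurry hf _ _).deriv]
  refine (h₁.deriv.trans ?_).trans h₂.deriv.symm
  simpa using hsymm

theorem ContDiff.of_uncurry_left (hf : ContDiff ℝ (⊤ : ℕ∞) (Function.uncurry f)) (t : ℝ) :
    ContDiff ℝ (⊤ : ℕ∞) (f t) :=
  hf.comp (contDiff_const.prodMk contDiff_id)

/-- Differentiation under the integral sign over a compact interval. -/
theorem hasDerivAt_intervalIntegral_of_contDiff [CompleteSpace E]
    (hf : ContDiff ℝ (⊤ : ℕ∞) (Function.uncurry f)) (a b t : ℝ) :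
    HasDerivAt (fun s => ∫ y in a..b, f s y) (∫ y in a..b, deriv (fun s => f s y) t) t := by
  have hc := (contDiff_uncurry_deriv_fst hf).continuous
  obtain ⟨M, hM⟩ := ((isCompact_closedBall t 1).prod (isCompact_uIcc (a := a) (b := b)))
    |>.exists_bound_of_continuousOn hc.continuousOn
  refine (intervalIntegral.hasDerivAt_integral_of_dominated_loc_of_deriv_le (bound := fun _ => M)
    (F' := fun s y => deriv (fun s => f s y) s)
    (Metric.closedBall_mem_nhds t one_pos) (.of_forall fun s => ?_) ?_ ?_ ?_ ?_ ?_).2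
  · exact (hf.of_uncurry_left s).continuous.aestronglyMeasurable
  · exact (hf.of_uncurry_left t).continuous.intervalIntegrable _ _
  · exact (hc.comp (Continuous.prodMk_right t)).aestronglyMeasurable
  · exact .of_forall fun y hy s hs => hM (s, y) ⟨hs, uIoc_subset_uIcc hy⟩
  · exact intervalIntegrable_const
  · exact .of_forall fun y _ s _ =>
      (hasDerivAt_fst_of_contDiff_uncurry hf s y).differentiableAt.hasDerivAt

end PartialDerivatives

theorem deriv_eq_zero_of_eqOn_Ici {E : Type*} [NormedAddCommGroup E] [NormedSpace ℝ E]
    {f : ℝ → E} {a t : ℝ} (hf : DifferentiableAt ℝ f t) (h : ∀ s ≥ a, f s = 0) (ht : a ≤ t) :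
    deriv f t = 0 := by
  have h' : EqOn f (fun _ => 0) (Ici a) := h
  rw [← hf.derivWithin (uniqueDiffOn_Ici a t ht), derivWithin_congr h' (h t ht)]
  simp

/-- The elliptic estimate for `ψ'' - κ² ψ = w` with Dirichlet boundary conditions. -/
theorem elliptic_estimate {ψ w : ℝ → ℂ} {κ : ℝ} (hκ : 1 ≤ κ ^ 2)
    (hψ : ContDiff ℝ (⊤ : ℕ∞) ψ) (hw : Continuous w) (hl : ψ (-1) = 0) (hr : ψ 1 = 0)
    (heq : ∀ y ∈ Icc (-1 : ℝ) 1, deriv (deriv ψ) y - (κ : ℂ) ^ 2 * ψ y = w y) :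
    (∫ y in (-1 : ℝ)..1, ‖ψ y‖ ^ 2) + (∫ y in (-1 : ℝ)..1, ‖deriv ψ y‖ ^ 2) ≤
      ∫ y in (-1 : ℝ)..1, ‖w y‖ ^ 2 := by
  have hψ' : ContDiff ℝ (⊤ : ℕ∞) (deriv ψ) := (contDiff_infty_iff_deriv.1 hψ).2
  have hψ'' : ContDiff ℝ (⊤ : ℕ∞) (deriv (deriv ψ)) := (contDiff_infty_iff_deriv.1 hψ').2
  have c₀ := hψ.continuous
  have c₁ := hψ'.continuous
  have c₂ := hψ''.continuous
  have hparts : ∫ y in (-1 : ℝ)..1,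
      2 * (inner ℝ (ψ y) (deriv (deriv ψ) y) + inner ℝ (deriv ψ y) (deriv ψ y)) = 0 := by
    rw [intervalIntegral.integral_const_mul, intervalIntegral.integral_eq_sub_of_hasDerivAt
      (f := fun y => inner ℝ (ψ y) (deriv ψ y))
      (fun y _ => (hψ.differentiable (by simp) y).hasDerivAt.inner ℝ
        (hψ'.differentiable (by simp) y).hasDerivAt)
      (Continuous.intervalIntegrable (by fun_prop) _ _)]
    simp [hl, hr]
  rw [← intervalIntegral.integral_add (Continuous.intervalIntegrable (by fun_prop) _ _)
    (Continuous.intervalIntegrable (by fun_prop) _ _), ← add_zero (∫ y in (-1 : ℝ)..1, ‖w y‖ ^ 2),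
    ← hparts, ← intervalIntegral.integral_add (Continuous.intervalIntegrable (by fun_prop) _ _)
    (Continuous.intervalIntegrable (by fun_prop) _ _)]
  refine intervalIntegral.integral_mono_on (by norm_num)
    (Continuous.intervalIntegrable (by fun_prop) _ _)
    (Continuous.intervalIntegrable (by fun_prop) _ _) fun y hy => ?_
  have h₂ : deriv (deriv ψ) y = w y + (κ ^ 2 : ℝ) • ψ y := by
    rw [← heq y hy]; simp
  rw [h₂, inner_add_right, inner_smul_right, real_inner_self_eq_norm_sq,
    real_inner_self_eq_norm_sq]
  have hcs := neg_le_of_abs_le (abs_real_inner_le_norm (ψ y) (w y))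
  nlinarith [sq_nonneg (‖ψ y‖ - ‖w y‖), sq_nonneg ‖deriv ψ y‖,
    mul_le_mul_of_nonneg_right hκ (sq_nonneg ‖ψ y‖)]

/-- Weighted Young inequalities behind the energy estimate, with `A = μ^{1/3}`, `B = |k|^{1/3}`. -/
theorem weighted_young {A B δ P g x z w h p q : ℝ} (hA : 0 < A) (hB : 0 < B) (hδ : 0 < δ)
    (hP : P ≤ g - A ^ 3 * z ^ 2 + B ^ 3 * h * z + B ^ 3 * (1 + δ) * w * x +
      B ^ 3 * δ * (p + q) * x) :
    A ^ 2 / B ^ 2 * P + 1 / 2 * (A ^ 5 / B ^ 2) * z ^ 2 ≤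
      A ^ 2 / B ^ 2 * g + (16 + 10 * δ / 2) * A ^ 3 * x ^ 2 +
        (1 / 16 + δ / 16) * (A * B ^ 2) * w ^ 2 + δ / 2 * (A * B ^ 2) * (p ^ 2 + q ^ 2) +
        10 * (B ^ 4 / A) * h ^ 2 := by
  have hP' := mul_le_mul_of_nonneg_left hP (show 0 ≤ A ^ 2 / B ^ 2 by positivity)
  have hexp : A ^ 2 / B ^ 2 * (g - A ^ 3 * z ^ 2 + B ^ 3 * h * z + B ^ 3 * (1 + δ) * w * x +
      B ^ 3 * δ * (p + q) * x) = A ^ 2 / B ^ 2 * g - A ^ 5 / B ^ 2 * z ^ 2 + A ^ 2 * B * h * z +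
      A ^ 2 * B * (1 + δ) * w * x + A ^ 2 * B * δ * (p + q) * x := by
    field_simp
  have hθ : A ^ 2 * B * h * z ≤
      1 / 2 * (A ^ 5 / B ^ 2) * z ^ 2 + 1 / 2 * (B ^ 4 / A) * h ^ 2 := by
    have hsq : 0 ≤ (A ^ 3 * z - B ^ 3 * h) ^ 2 / (2 * A * B ^ 2) := by positivity
    have hid : (A ^ 3 * z - B ^ 3 * h) ^ 2 / (2 * A * B ^ 2) =
        1 / 2 * (A ^ 5 / B ^ 2) * z ^ 2 + 1 / 2 * (B ^ 4 / A) * h ^ 2 - A ^ 2 * B * h * z := by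
      field_simp
      ring
    linarith
  have hw : A ^ 2 * B * (1 + δ) * w * x ≤
      (1 + δ) * (4 * A ^ 3 * x ^ 2 + 1 / 16 * (A * B ^ 2) * w ^ 2) := by
    nlinarith [mul_nonneg (mul_nonneg hA.le (by linarith : 0 ≤ 1 + δ))
      (sq_nonneg (2 * A * x - B * w / 4))]
  have hψ : A ^ 2 * B * δ * (p + q) * x ≤
      δ * (A ^ 3 * x ^ 2) + δ / 2 * (A * B ^ 2) * (p ^ 2 + q ^ 2) := by
    nlinarith [mul_nonneg (mul_nonneg hA.le hδ.le) (sq_nonneg (A * x - B * (p + q) / 2)),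
      mul_nonneg (mul_nonneg hA.le hδ.le) (sq_nonneg (B * (p - q)))]
  have hx : 0 ≤ A ^ 3 * x ^ 2 := by positivity
  have hh : 0 ≤ B ^ 4 / A * h ^ 2 := by positivity
  linarith

/-- The energy estimate at a fixed time, with `A = μ^{1/3}`, `B = |k|^{1/3}`; here `w'` plays the
role of the time derivative of `w`. -/
theorem energy_estimate {A B δ κ : ℝ} (hA : 0 < A) (hB : 0 < B) (hδ : 0 < δ)
    (hκB : |κ| = B ^ 3) (hκ : 1 ≤ κ ^ 2) {u : ℝ → ℝ} {w w' ψ θ : ℝ → ℂ}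
    (hu : ContDiff ℝ (⊤ : ℕ∞) u) (hw : ContDiff ℝ (⊤ : ℕ∞) w) (hw' : ContDiff ℝ (⊤ : ℕ∞) w')
    (hψ : ContDiff ℝ (⊤ : ℕ∞) ψ) (hθ : Continuous θ)
    (hu₁ : ∀ y ∈ Icc (-1 : ℝ) 1, |deriv u y - 1| ≤ δ)
    (hu₂ : ∀ y ∈ Icc (-1 : ℝ) 1, |deriv (deriv u) y| ≤ δ)
    (hu₃ : ∀ y ∈ Icc (-1 : ℝ) 1, |deriv (deriv (deriv u)) y| ≤ δ)
    (hwl : w (-1) = 0) (hwr : w 1 = 0) (hwl' : w' (-1) = 0) (hwr' : w' 1 = 0)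
    (hψl : ψ (-1) = 0) (hψr : ψ 1 = 0)
    (helliptic : ∀ y ∈ Icc (-1 : ℝ) 1, deriv (deriv ψ) y - (κ : ℂ) ^ 2 * ψ y = w y)
    (hevol : ∀ y ∈ Icc (-1 : ℝ) 1, w' y + Complex.I * κ * u y * w y
      - Complex.I * κ * (deriv (deriv u) y : ℝ) * ψ y - (A ^ 3 : ℝ) * deriv (deriv w) y
      = -(Complex.I * κ * θ y)) :
    A ^ 2 / B ^ 2 * (∫ y in (-1 : ℝ)..1, inner ℝ (deriv w y) (deriv w' y)) +
        1 / 2 * (A ^ 5 / B ^ 2) * (∫ y in (-1 : ℝ)..1, ‖deriv (deriv w) y‖ ^ 2) ≤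
      (16 + 10 * δ / 2) * A ^ 3 * (∫ y in (-1 : ℝ)..1, ‖deriv w y‖ ^ 2) +
        (1 / 16 + 10 * δ / 2) * (A * B ^ 2) * (∫ y in (-1 : ℝ)..1, ‖w y‖ ^ 2) +
        10 * (B ^ 4 / A) * (∫ y in (-1 : ℝ)..1, ‖θ y‖ ^ 2) := by
  have du {F : Type} [NormedAddCommGroup F] [NormedSpace ℝ F] {f : ℝ → F}
      (hf : ContDiff ℝ (⊤ : ℕ∞) f) : ContDiff ℝ (⊤ : ℕ∞) (deriv f) :=
    (contDiff_infty_iff_deriv.1 hf).2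
  have hd {F : Type} [NormedAddCommGroup F] [NormedSpace ℝ F] {f : ℝ → F}
      (hf : ContDiff ℝ (⊤ : ℕ∞) f) (y : ℝ) : HasDerivAt f (deriv f y) y :=
    (hf.differentiable (by simp) y).hasDerivAt
  have cu := hu.continuous
  have cu₁ := (du hu).continuous
  have cu₂ := (du (du hu)).continuous
  have cu₃ := (du (du (du hu))).continuous
  have cw := hw.continuous
  have cw₁ := (du hw).continuous
  have cw₂ := (du (du hw)).continuous
  have cw' := hw'.continuous
  have cw₁' := (du hw').continuous
  have cψ := hψ.continuous
  have cψ₁ := (du hψ).continuous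
  -- the flux whose total derivative encodes every integration by parts
  let v : ℝ → ℂ := fun y => w' y + Complex.I * κ * (u y * w y - (deriv (deriv u) y : ℝ) * ψ y)
  let v' : ℝ → ℂ := fun y => deriv w' y + Complex.I * κ *
    ((deriv u y : ℝ) * w y + u y * deriv w y -
      ((deriv (deriv (deriv u)) y : ℝ) * ψ y + (deriv (deriv u) y : ℝ) * deriv ψ y))
  let g : ℝ → ℝ := fun y => inner ℝ (v y) (deriv (deriv w) y) + inner ℝ (v' y) (deriv w y)
  have cv : Continuous v := by fun_prop
  have cv' : Continuous v' := by fun_prop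
  have cg : Continuous g := by fun_prop
  have hg : ∫ y in (-1 : ℝ)..1, g y = 0 := by
    rw [intervalIntegral.integral_eq_sub_of_hasDerivAt (f := fun y => inner ℝ (v y) (deriv w y))
      (fun y _ => ?_) (cg.intervalIntegrable _ _)]
    · simp [v, hwl, hwr, hwl', hwr', hψl, hψr]
    · have hv : HasDerivAt v (v' y) y :=
        (hd hw' y).add ((((hd hu y).ofReal_comp.mul (hd hw y)).sub
          ((hd (du (du hu)) y).ofReal_comp.mul (hd hψ y))).const_mul (Complex.I * κ))
      exact hv.inner ℝ (hd (du hw) y)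
  have hpoint (y : ℝ) (hy : y ∈ Icc (-1 : ℝ) 1) :
      inner ℝ (deriv w y) (deriv w' y) ≤ g y - A ^ 3 * ‖deriv (deriv w) y‖ ^ 2 +
        B ^ 3 * ‖θ y‖ * ‖deriv (deriv w) y‖ + B ^ 3 * (1 + δ) * ‖w y‖ * ‖deriv w y‖ +
        B ^ 3 * δ * (‖ψ y‖ + ‖deriv ψ y‖) * ‖deriv w y‖ := by
    have hv : v y = (A ^ 3 : ℝ) • deriv (deriv w) y - Complex.I * κ * θ y := by
      rw [Complex.real_smul]
      linear_combination hevol y hy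
    have hv' : v' y = deriv w' y + Complex.I * κ * (deriv u y : ℝ) * w y +
        (κ * u y : ℝ) • (Complex.I * deriv w y) - Complex.I * κ *
        ((deriv (deriv (deriv u)) y : ℝ) * ψ y + (deriv (deriv u) y : ℝ) * deriv ψ y) := by
      simp only [v', Complex.real_smul]
      push_cast
      ring
    have hrot : inner ℝ (Complex.I * deriv w y) (deriv w y) = (0 : ℝ) := by
      simp [Complex.inner]
      ring
    have hgy : g y = A ^ 3 * ‖deriv (deriv w) y‖ ^ 2
        - inner ℝ (Complex.I * κ * θ y) (deriv (deriv w) y)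
        + inner ℝ (deriv w y) (deriv w' y)
        + inner ℝ (Complex.I * κ * (deriv u y : ℝ) * w y) (deriv w y)
        - inner ℝ (Complex.I * κ * ((deriv (deriv (deriv u)) y : ℝ) * ψ y +
          (deriv (deriv u) y : ℝ) * deriv ψ y)) (deriv w y) := by
      simp only [g]
      rw [hv, hv', inner_sub_left, inner_sub_left, inner_add_left, inner_add_left,
        real_inner_smul_left, real_inner_smul_left, hrot, real_inner_self_eq_norm_sq,
        real_inner_comm (deriv w y) (deriv w' y)]
      ring
    have b₁ : inner ℝ (Complex.I * κ * θ y) (deriv (deriv w) y) ≤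
        B ^ 3 * ‖θ y‖ * ‖deriv (deriv w) y‖ := by
      refine (real_inner_le_norm _ _).trans_eq ?_
      simp [hκB]
    have b₂ : -inner ℝ (Complex.I * κ * (deriv u y : ℝ) * w y) (deriv w y) ≤
        B ^ 3 * (1 + δ) * ‖w y‖ * ‖deriv w y‖ := by
      have h₁ : |deriv u y| ≤ 1 + δ := by
        have := abs_le.1 (hu₁ y hy)
        exact abs_le.2 ⟨by linarith, by linarith⟩
      refine (neg_le_abs _).trans ((abs_real_inner_le_norm _ _).trans ?_)
      simp only [norm_mul, Complex.norm_I, Complex.norm_real, Real.norm_eq_abs, one_mul, hκB]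
      gcongr
    have b₃ : inner ℝ (Complex.I * κ * ((deriv (deriv (deriv u)) y : ℝ) * ψ y +
          (deriv (deriv u) y : ℝ) * deriv ψ y)) (deriv w y) ≤
        B ^ 3 * δ * (‖ψ y‖ + ‖deriv ψ y‖) * ‖deriv w y‖ := by
      refine (real_inner_le_norm _ _).trans ?_
      simp only [norm_mul, Complex.norm_I, Complex.norm_real, Real.norm_eq_abs, one_mul, hκB]
      rw [mul_assoc (B ^ 3) δ, mul_add δ]
      gcongr
      refine (norm_add_le _ _).trans ?_
      simp only [norm_mul, Complex.norm_real, Real.norm_eq_abs]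
      gcongr
      · exact hu₃ y hy
      · exact hu₂ y hy
    linarith
  have hint := intervalIntegral.integral_mono_on (μ := MeasureTheory.volume)
    (by norm_num : (-1 : ℝ) ≤ 1)
    (Continuous.intervalIntegrable (by fun_prop) _ _)
    (Continuous.intervalIntegrable (by fun_prop) _ _)
    fun y hy => weighted_young hA hB hδ (hpoint y hy)
  have hell := elliptic_estimate hκ hψ cw hψl hψr helliptic
  have ii {f : ℝ → ℝ} (hf : Continuous f) :
      IntervalIntegrable f MeasureTheory.volume (-1) 1 := hf.intervalIntegrable _ _
  rw [intervalIntegral.integral_add (ii (by fun_prop)) (ii (by fun_prop)),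
    intervalIntegral.integral_add (ii (by fun_prop)) (ii (by fun_prop)),
    intervalIntegral.integral_add (ii (by fun_prop)) (ii (by fun_prop)),
    intervalIntegral.integral_add (ii (by fun_prop)) (ii (by fun_prop)),
    intervalIntegral.integral_add (ii (by fun_prop)) (ii (by fun_prop))] at hint
  simp only [intervalIntegral.integral_const_mul] at hint
  rw [hg, intervalIntegral.integral_add (ii (by fun_prop)) (ii (by fun_prop))] at hint
  have hell' := mul_le_mul_of_nonneg_left hell
    (show 0 ≤ δ / 2 * (A * B ^ 2) by positivity)
  have hN : 0 ≤ δ * (A * B ^ 2) * ∫ y in (-1 : ℝ)..1, ‖w y‖ ^ 2 :=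
    mul_nonneg (by positivity)
      (intervalIntegral.integral_nonneg (by norm_num) fun y _ => by positivity)
  linarith

theorem stmt_13 :
    ∃ C₀ : ℝ, 0 < C₀ ∧
    ∀ μ δ₀ : ℝ, μ ∈ Ioc (0:ℝ) 1 → δ₀ ∈ Ioo (0:ℝ) (1/2) →
    ∀ k : ℤ, k ≠ 0 →
    ∀ U : ℝ → ℝ → ℝ, ContDiff ℝ (⊤ : ℕ∞) (Function.uncurry U) →
    (∀ t ≥ (0:ℝ), ∀ y ∈ Icc (-1:ℝ) 1, |deriv (U t) y - 1| ≤ δ₀) →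
    (∀ t ≥ (0:ℝ), ∀ y ∈ Icc (-1:ℝ) 1, |deriv (deriv (U t)) y| ≤ δ₀) →
    (∀ t ≥ (0:ℝ), ∀ y ∈ Icc (-1:ℝ) 1, |deriv (deriv (deriv (U t))) y| ≤ δ₀) →
    ∀ ω ψ θ : ℝ → ℝ → ℂ,
    ContDiff ℝ (⊤ : ℕ∞) (Function.uncurry ω) → ContDiff ℝ (⊤ : ℕ∞) (Function.uncurry ψ) →
    ContDiff ℝ (⊤ : ℕ∞) (Function.uncurry θ) →
    (∀ t ≥ (0:ℝ), ω t (-1) = 0 ∧ ω t 1 = 0 ∧ ψ t (-1) = 0 ∧ ψ t 1 = 0 ∧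
      θ t (-1) = 0 ∧ θ t 1 = 0) →
    (∀ t ≥ (0:ℝ), ∀ y ∈ Icc (-1:ℝ) 1,
      deriv (deriv (ψ t)) y - (k : ℂ)^2 * ψ t y = ω t y) →
    (∀ t ≥ (0:ℝ), ∀ y ∈ Icc (-1:ℝ) 1,
      deriv (fun s => ω s y) t + Complex.I * (k : ℂ) * (U t y : ℂ) * ω t y
        - Complex.I * (k : ℂ) * (Complex.ofReal (deriv (deriv (U t)) y)) * ψ t y
        - (μ : ℂ) * deriv (deriv (ω t)) y = -(Complex.I * (k : ℂ) * θ t y)) →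
    ∀ t ≥ (0:ℝ), ∃ d : ℝ,
      HasDerivWithinAt (fun s => μ ^ ((2:ℝ)/3) * |(k : ℝ)| ^ (-(2:ℝ)/3) *
          ∫ y in (-1:ℝ)..1, ‖deriv (ω s) y‖^2) d (Ici 0) t ∧
      (1/2) * d + (1/2) * μ ^ ((5:ℝ)/3) * |(k : ℝ)| ^ (-(2:ℝ)/3) *
          (∫ y in (-1:ℝ)..1, ‖deriv (deriv (ω t)) y‖^2) ≤
        (16 + C₀ * δ₀ / 2) * μ * (∫ y in (-1:ℝ)..1, ‖deriv (ω t) y‖^2)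
          + (1/16 + C₀ * δ₀ / 2) * μ ^ ((1:ℝ)/3) * |(k : ℝ)| ^ ((2:ℝ)/3) *
              (∫ y in (-1:ℝ)..1, ‖ω t y‖^2)
          + C₀ * μ ^ (-(1:ℝ)/3) * |(k : ℝ)| ^ ((4:ℝ)/3) *
              (∫ y in (-1:ℝ)..1, ‖θ t y‖^2) := by
  refine ⟨10, by norm_num, ?_⟩
  intro μ δ₀ hμ hδ k hk U hU hU₁ hU₂ hU₃ ω ψ θ hω hψ hθ hbc helliptic hevol t ht
  have hμ0 : 0 < μ := hμ.1
  have hk1 : 1 ≤ |(k : ℝ)| := by exact_mod_cast Int.one_le_abs hk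
  have hk0 : 0 < |(k : ℝ)| := by linarith
  set A : ℝ := μ ^ ((1 : ℝ) / 3) with hAdef
  set B : ℝ := |(k : ℝ)| ^ ((1 : ℝ) / 3) with hBdef
  have hA : 0 < A := by positivity
  have hB : 0 < B := by positivity
  have powA (n : ℕ) : μ ^ ((1 : ℝ) / 3 * n) = A ^ n := Real.rpow_mul_natCast hμ0.le _ n
  have powB (n : ℕ) : |(k : ℝ)| ^ ((1 : ℝ) / 3 * n) = B ^ n :=
    Real.rpow_mul_natCast hk0.le _ n
  have hA2 : μ ^ ((2 : ℝ) / 3) = A ^ 2 := by rw [← powA]; norm_num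
  have hA3 : μ = A ^ 3 := by rw [← powA]; norm_num
  have hA5 : μ ^ ((5 : ℝ) / 3) = A ^ 5 := by rw [← powA]; norm_num
  have hAneg : μ ^ (-(1 : ℝ) / 3) = A⁻¹ := by rw [neg_div, Real.rpow_neg hμ0.le]
  have hB2 : |(k : ℝ)| ^ ((2 : ℝ) / 3) = B ^ 2 := by rw [← powB]; norm_num
  have hB3 : |(k : ℝ)| = B ^ 3 := by rw [← powB]; norm_num
  have hB4 : |(k : ℝ)| ^ ((4 : ℝ) / 3) = B ^ 4 := by rw [← powB]; norm_num
  have hBneg : |(k : ℝ)| ^ (-(2 : ℝ) / 3) = (B ^ 2)⁻¹ := by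
    rw [neg_div, Real.rpow_neg hk0.le, hB2]
  have hω₁ := contDiff_uncurry_deriv_snd hω
  have hω' : ContDiff ℝ (⊤ : ℕ∞) fun y => deriv (fun s => ω s y) t :=
    (contDiff_uncurry_deriv_fst hω).of_uncurry_left t
  have hdω (y : ℝ) : DifferentiableAt ℝ (fun s => ω s y) t :=
    (hasDerivAt_fst_of_contDiff_uncurry hω t y).differentiableAt
  have hsq : ContDiff ℝ (⊤ : ℕ∞) (Function.uncurry fun s y => ‖deriv (ω s) y‖ ^ 2) :=
    hω₁.norm_sq ℝ
  have hderiv (y : ℝ) : deriv (fun s => ‖deriv (ω s) y‖ ^ 2) t =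
      2 * inner ℝ (deriv (ω t) y) (deriv (fun z => deriv (fun s => ω s z) t) y) := by
    rw [← deriv_fst_deriv_snd_comm hω]
    exact (hasDerivAt_fst_of_contDiff_uncurry hω₁ t y).differentiableAt.hasDerivAt.norm_sq.deriv
  have hmain := hasDerivAt_intervalIntegral_of_contDiff hsq (-1) 1 t
  simp only [hderiv, intervalIntegral.integral_const_mul] at hmain
  refine ⟨_, (hmain.const_mul _).hasDerivWithinAt, ?_⟩
  have henergy := energy_estimate (δ := δ₀) (κ := k) (u := U t) (w := ω t) (ψ := ψ t) (θ := θ t)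
    hA hB hδ.1 hB3 (by rw [← sq_abs]; nlinarith) (hU.of_uncurry_left t) (hω.of_uncurry_left t)
    hω' (hψ.of_uncurry_left t) (hθ.of_uncurry_left t).continuous
    (hU₁ t ht) (hU₂ t ht) (hU₃ t ht) (hbc t ht).1 (hbc t ht).2.1
    (deriv_eq_zero_of_eqOn_Ici (hdω _) (fun s hs => (hbc s hs).1) ht)
    (deriv_eq_zero_of_eqOn_Ici (hdω _) (fun s hs => (hbc s hs).2.1) ht)
    (hbc t ht).2.2.1 (hbc t ht).2.2.2.1
    (fun y hy => by simpa using helliptic t ht y hy)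
    (fun y hy => by rw [← hA3]; simpa using hevol t ht y hy)
  rw [← hA3] at henergy
  rw [hA2, hA5, hAneg, hB2, hB4, hBneg]
  simp only [div_eq_mul_inv] at henergy ⊢
  linarith
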